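/- Let F : ℝ³ × ℝ³ → [0,∞] be measurable. Then the pre-post collisional change of variables holds: ∫_{ℝ³} ∫_{ℝ³} ∫_{S²} F( p'(p,q,ω), q'(p,q,ω) ) / (|p||q|) dω d³q d³p = 4π ∫_{ℝ³} ∫_{ℝ³} F(p,q) / (|p||q|) d³q d³p, where p', q' are the post-collision momenta defined by the stated parametrization and dω is the surface measure on the unit sphere S². -/

import Mathlib

noncomputable section

open MeasureTheory Real Metric
open scoped RealInnerProductSpace

/-- Momentum space `ℝ³`. -/
abbrev R3 : Type := EuclideanSpace ℝ (Fin 3)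

/-- The relative momentum `ρ(p,q) = √(2(|p||q| − p·q))`. -/
def relMom (p q : R3) : ℝ := Real.sqrt (2 * (‖p‖ * ‖q‖ - ⟪p, q⟫))

/-- Post-collision momentum `p'`. -/
def pPost (p q ω : R3) : R3 :=
  (1 / 2 : ℝ) • (p + q) + (relMom p q / 2) • ω
    + (⟪p + q, ω⟫ / 2 / (‖p‖ + ‖q‖ + relMom p q)) • (p + q)

/-- Post-collision momentum `q'`. -/
def qPost (p q ω : R3) : R3 :=
  (1 / 2 : ℝ) • (p + q) - (relMom p q / 2) • ω
    - (⟪p + q, ω⟫ / 2 / (‖p‖ + ‖q‖ + relMom p q)) • (p + q)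

/-- Post-collision energy `p'⁰`. -/
def p0Post (p q ω : R3) : ℝ := (‖p‖ + ‖q‖) / 2 + ⟪p + q, ω⟫ / 2

/-- Post-collision energy `q'⁰`. -/
def q0Post (p q ω : R3) : ℝ := (‖p‖ + ‖q‖) / 2 - ⟪p + q, ω⟫ / 2

/-- The surface measure `dω` on the unit sphere `S² ⊂ ℝ³` (total mass `4π`). -/
def sphMeasure : Measure (sphere (0 : R3) 1) := (volume : Measure R3).toSphere

/-- The (modified, for `ε > 0`) massless Boltzmann collision operator with scattering
cross-section `σ = C₁ h^{-b}`. -/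
def Qcoll (C₁ b ε : ℝ) (f : R3 → ℝ) (p : R3) : ℝ :=
  C₁ * ∫ q : R3, ∫ ω : sphere (0 : R3) 1,
      (if ε ≤ relMom p q then relMom p q ^ (2 - b) / (‖p‖ * ‖q‖) else 0)
        * (f (pPost p q ω) * f (qPost p q ω) - f p * f q) ∂sphMeasure

/-- Energy as a function of total momentum `P` and `y = ρ ω`. -/
def enP (P y : R3) : ℝ := Real.sqrt (‖y‖ ^ 2 + ‖P‖ ^ 2)

/-- The post-collision momentum as a function of the total momentum and `y = ρ ω`. -/
def TP (P y : R3) : R3 :=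
  (1 / 2 : ℝ) • (P + y) + (⟪P, y⟫ * (2 * (‖y‖ * (enP P y + ‖y‖)))⁻¹) • P

lemma enP_sq (P y : R3) : enP P y ^ 2 = ‖y‖ ^ 2 + ‖P‖ ^ 2 := Real.sq_sqrt (by positivity)

lemma enP_nonneg (P y : R3) : 0 ≤ enP P y := Real.sqrt_nonneg _

lemma enP_neg (P y : R3) : enP P (-y) = enP P y := by simp [enP]

lemma norm_lt_enP (P y : R3) (hy : y ≠ 0) : ‖P‖ < enP P y := by
  apply Real.lt_sqrt_of_sq_lt
  have : 0 < ‖y‖ := norm_pos_iff.2 hy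
  nlinarith

lemma sub_TP (P y : R3) : P - TP P y = TP P (-y) := by
  simp only [TP, enP_neg, norm_neg, inner_neg_right]
  module

lemma abs_inner_div_lt (P y : R3) (hy : y ≠ 0) : |⟪P, y⟫ / ‖y‖| < enP P y := by
  have h0 : 0 < ‖y‖ := norm_pos_iff.2 hy
  rw [abs_div, abs_norm, div_lt_iff₀ h0]
  have := abs_real_inner_le_norm P y
  have := norm_lt_enP P y hy
  nlinarith

lemma norm_TP (P y : R3) (hy : y ≠ 0) : ‖TP P y‖ = (enP P y + ⟪P, y⟫ / ‖y‖) / 2 := by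
  have h0 : 0 < ‖y‖ := norm_pos_iff.2 hy
  have h1 := abs_lt.1 (abs_inner_div_lt P y hy)
  rw [← sq_eq_sq₀ (norm_nonneg _) (by linarith)]
  have hE := enP_sq P y
  have hE0 := enP_nonneg P y
  have e : TP P y = (1 / 2 + ⟪P, y⟫ * (2 * (‖y‖ * (enP P y + ‖y‖)))⁻¹) • P + (1 / 2 : ℝ) • y := by
    rw [TP]; module
  rw [e, norm_add_sq_real, norm_smul, norm_smul, mul_pow, mul_pow, real_inner_smul_left,
    real_inner_smul_right, Real.norm_eq_abs, Real.norm_eq_abs, sq_abs, sq_abs,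
    show ‖P‖ ^ 2 = enP P y ^ 2 - ‖y‖ ^ 2 by linarith]
  generalize enP P y = E at *
  generalize ‖y‖ = r at *
  have : E + r ≠ 0 := by positivity
  field_simp
  ring

lemma norm_sub_TP (P y : R3) (hy : y ≠ 0) :
    ‖P - TP P y‖ = (enP P y - ⟪P, y⟫ / ‖y‖) / 2 := by
  rw [sub_TP, norm_TP P _ (neg_ne_zero.2 hy), enP_neg, norm_neg, inner_neg_right]; ring

lemma relMom_sq (p q : R3) : relMom p q ^ 2 = 2 * (‖p‖ * ‖q‖ - ⟪p, q⟫) :=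
  Real.sq_sqrt (by have := real_inner_le_norm p q; linarith)

lemma relMom_nonneg (p q : R3) : 0 ≤ relMom p q := Real.sqrt_nonneg _

lemma relMom_sq' (p q : R3) : relMom p q ^ 2 = (‖p‖ + ‖q‖) ^ 2 - ‖p + q‖ ^ 2 := by
  rw [relMom_sq, norm_add_sq_real]; ring

lemma relMom_TP (P y : R3) (hy : y ≠ 0) : relMom (TP P y) (P - TP P y) = ‖y‖ := by
  rw [← sq_eq_sq₀ (relMom_nonneg _ _) (norm_nonneg _), relMom_sq', norm_TP P y hy,
    norm_sub_TP P y hy, add_sub_cancel]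
  have hE := enP_sq P y
  linear_combination hE

/-- The inverse of `TP P`. -/
def SP (P p : R3) : R3 :=
  (2 : ℝ) • p - P - ((‖p‖ - ‖P - p‖) / (‖p‖ + ‖P - p‖ + relMom p (P - p))) • P

lemma SP_TP (P y : R3) (hy : y ≠ 0) : SP P (TP P y) = y := by
  have h0 : 0 < ‖y‖ := norm_pos_iff.2 hy
  have hE0 := enP_nonneg P y
  rw [SP, relMom_TP P y hy, norm_TP P y hy, norm_sub_TP P y hy]
  have h : ((enP P y + ⟪P, y⟫ / ‖y‖) / 2 - (enP P y - ⟪P, y⟫ / ‖y‖) / 2) /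
      ((enP P y + ⟪P, y⟫ / ‖y‖) / 2 + (enP P y - ⟪P, y⟫ / ‖y‖) / 2 + ‖y‖)
      = 2 * (⟪P, y⟫ * (2 * (‖y‖ * (enP P y + ‖y‖)))⁻¹) := by
    generalize enP P y = E at *
    generalize ‖y‖ = r at *
    have : E + r ≠ 0 := by positivity
    rw [show (E + ⟪P, y⟫ / r) / 2 + (E - ⟪P, y⟫ / r) / 2 + r = E + r by ring]
    field_simp
    ring
  rw [h, TP]
  module

lemma norm_SP (P p : R3) (hp : relMom p (P - p) ≠ 0) : ‖SP P p‖ = relMom p (P - p) := by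
  have h0 : 0 < relMom p (P - p) := lt_of_le_of_ne (relMom_nonneg _ _) hp.symm
  rw [← sq_eq_sq₀ (norm_nonneg _) h0.le]
  obtain ⟨q, rfl⟩ : ∃ q, P = p + q := ⟨P - p, by abel⟩
  rw [SP]
  simp only [add_sub_cancel_left] at *
  have e1 := relMom_sq p q
  have e2 : (2 : ℝ) • p - (p + q) = p - q := by module
  have e3 : ⟪p - q, p + q⟫ = ‖p‖ ^ 2 - ‖q‖ ^ 2 := by
    simp only [inner_add_right, inner_sub_left, real_inner_self_eq_norm_sq, real_inner_comm p q]
    ring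
  rw [e2, norm_sub_sq_real, norm_smul, mul_pow, Real.norm_eq_abs, sq_abs, inner_smul_right, e3,
    norm_add_sq_real, norm_sub_sq_real, show ⟪p, q⟫ = ‖p‖ * ‖q‖ - relMom p q ^ 2 / 2 by linarith]
  have := norm_nonneg p
  have := norm_nonneg q
  generalize relMom p q = r at *
  generalize ‖p‖ = a at *
  generalize ‖q‖ = b at *
  have : a + b + r ≠ 0 := by positivity
  field_simp
  ring

lemma TP_SP (P p : R3) (hp : relMom p (P - p) ≠ 0) : TP P (SP P p) = p := by
  have h0 : 0 < relMom p (P - p) := lt_of_le_of_ne (relMom_nonneg _ _) hp.symm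
  have hN := norm_SP P p hp
  have hE : enP P (SP P p) = ‖p‖ + ‖P - p‖ := by
    rw [enP, hN, relMom_sq', add_sub_cancel, sub_add_cancel, Real.sqrt_sq (by positivity)]
  have hI : ⟪P, SP P p⟫ = relMom p (P - p) * (‖p‖ - ‖P - p‖) := by
    clear hN hE
    obtain ⟨q, rfl⟩ : ∃ q, P = p + q := ⟨P - p, by abel⟩
    rw [SP]
    simp only [add_sub_cancel_left] at *
    have e1 := relMom_sq p q
    have e2 : (2 : ℝ) • p - (p + q) = p - q := by module
    have e3 : ⟪p + q, p - q⟫ = ‖p‖ ^ 2 - ‖q‖ ^ 2 := by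
      simp only [inner_add_left, inner_sub_right, real_inner_self_eq_norm_sq, real_inner_comm p q]
      ring
    rw [e2, inner_sub_right, inner_smul_right, e3, real_inner_self_eq_norm_sq,
      norm_add_sq_real, show ⟪p, q⟫ = ‖p‖ * ‖q‖ - relMom p q ^ 2 / 2 by linarith]
    have := norm_nonneg p
    have := norm_nonneg q
    generalize relMom p q = r at *
    generalize ‖p‖ = a at *
    generalize ‖q‖ = b at *
    have : a + b + r ≠ 0 := by positivity
    field_simp
    ring
  rw [TP, hE, hN, hI]
  have h : relMom p (P - p) * (‖p‖ - ‖P - p‖) *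
      (2 * (relMom p (P - p) * (‖p‖ + ‖P - p‖ + relMom p (P - p))))⁻¹
      = (1 / 2) * ((‖p‖ - ‖P - p‖) / (‖p‖ + ‖P - p‖ + relMom p (P - p))) := by
    have : ‖p‖ + ‖P - p‖ + relMom p (P - p) ≠ 0 := by positivity
    field_simp
  rw [h, SP]
  module

lemma pPost_eq (P p ω : R3) (hω : ‖ω‖ = 1) (hp : relMom p (P - p) ≠ 0) :
    pPost p (P - p) ω = TP P (relMom p (P - p) • ω) := by
  have h0 : 0 < relMom p (P - p) := lt_of_le_of_ne (relMom_nonneg _ _) hp.symm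
  have hN : ‖relMom p (P - p) • ω‖ = relMom p (P - p) := by
    rw [norm_smul, hω, mul_one, Real.norm_of_nonneg h0.le]
  have hE : enP P (relMom p (P - p) • ω) = ‖p‖ + ‖P - p‖ := by
    rw [enP, hN, relMom_sq', add_sub_cancel, sub_add_cancel, Real.sqrt_sq (by positivity)]
  rw [TP, hN, hE, pPost, add_sub_cancel, inner_smul_right]
  have h : relMom p (P - p) * ⟪P, ω⟫ *
      (2 * (relMom p (P - p) * (‖p‖ + ‖P - p‖ + relMom p (P - p))))⁻¹
      = ⟪P, ω⟫ / 2 / (‖p‖ + ‖P - p‖ + relMom p (P - p)) := by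
    have : ‖p‖ + ‖P - p‖ + relMom p (P - p) ≠ 0 := by positivity
    field_simp
  rw [h]
  module

lemma qPost_eq (P p ω : R3) : qPost p (P - p) ω = P - pPost p (P - p) ω := by
  rw [pPost, qPost, add_sub_cancel]
  module

lemma relMom_zero_null (P : R3) : volume {p : R3 | relMom p (P - p) = 0} = 0 := by
  have hsub : {p : R3 | relMom p (P - p) = 0} ⊆ (Submodule.span ℝ {P} : Submodule ℝ R3) := by
    intro p hp
    have hp : relMom p (P - p) = 0 := hp
    have h := relMom_sq p (P - p)
    rw [hp] at h
    have h2 : ⟪p, P - p⟫ = ‖p‖ * ‖P - p‖ := by linarith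
    rw [inner_eq_norm_mul_iff_real] at h2
    have h3 : (‖p‖ + ‖P - p‖) • p = ‖p‖ • P := by
      rw [add_smul, h2]; module
    rcases eq_or_ne p 0 with rfl | h0
    · simp
    have h4 : ‖p‖ + ‖P - p‖ ≠ 0 := by
      have := norm_pos_iff.2 h0
      positivity
    rw [SetLike.mem_coe, Submodule.mem_span_singleton]
    refine ⟨(‖p‖ + ‖P - p‖)⁻¹ * ‖p‖, ?_⟩
    rw [mul_smul, ← h3, smul_smul, inv_mul_cancel₀ h4, one_smul]
  refine measure_mono_null hsub (Measure.addHaar_submodule _ _ ?_)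
  intro h
  have h1 := finrank_span_le_card (R := ℝ) ({P} : Set R3)
  rw [h, finrank_top, finrank_euclideanSpace_fin] at h1
  simp at h1

/-- The radial profile. -/
lemma hasDerivAt_g (a r : ℝ) (hr : 0 < r) :
    HasDerivAt (fun r : ℝ => (2 * (r * (Real.sqrt (r ^ 2 + a ^ 2) + r)))⁻¹)
      (-1 / (2 * Real.sqrt (r ^ 2 + a ^ 2) * r ^ 2)) r := by
  have hpos : 0 < r ^ 2 + a ^ 2 := by positivity
  have hE := Real.sqrt_pos.2 hpos
  have h1 : HasDerivAt (fun r : ℝ => Real.sqrt (r ^ 2 + a ^ 2))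
      (r / Real.sqrt (r ^ 2 + a ^ 2)) r := by
    have := ((hasDerivAt_pow 2 r).add_const (a ^ 2)).sqrt hpos.ne'
    refine this.congr_deriv ?_
    push_cast
    field_simp
  have h2 := (((hasDerivAt_id' r).fun_mul (h1.fun_add (hasDerivAt_id' r))).const_mul 2).fun_inv
    (by positivity)
  refine h2.congr_deriv ?_
  generalize Real.sqrt (r ^ 2 + a ^ 2) = E at *
  field_simp
  ring

/-- derivative of the coefficient -/
def fD (P y : R3) : R3 →L[ℝ] ℝ :=
  (2 * (‖y‖ * (enP P y + ‖y‖)))⁻¹ • innerSL ℝ P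
    + (⟪P, y⟫ * (-1 / (2 * enP P y * ‖y‖ ^ 3))) • innerSL ℝ y

def TD (P y : R3) : R3 →L[ℝ] R3 :=
  (1 / 2 : ℝ) • ContinuousLinearMap.id ℝ R3 + (fD P y).smulRight P

lemma hasFDerivAt_norm' (y : R3) (hy : y ≠ 0) :
    HasFDerivAt (fun y : R3 => ‖y‖) (‖y‖⁻¹ • innerSL ℝ y) y := by
  have h0 : 0 < ‖y‖ := norm_pos_iff.2 hy
  have := (hasStrictFDerivAt_norm_sq y).hasFDerivAt.sqrt (by positivity)
  simp only [Real.sqrt_sq (norm_nonneg _)] at this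
  refine this.congr_fderiv ?_
  ext v
  simp
  field_simp

lemma hasFDerivAt_TP (P y : R3) (hy : y ≠ 0) : HasFDerivAt (TP P) (TD P y) y := by
  have h0 : 0 < ‖y‖ := norm_pos_iff.2 hy
  have hE : 0 < enP P y := (norm_nonneg P).trans_lt (norm_lt_enP P y hy)
  have h1 := (hasDerivAt_g ‖P‖ ‖y‖ h0).comp_hasFDerivAt y (hasFDerivAt_norm' y hy)
  have h2 : HasFDerivAt (fun y : R3 => ⟪P, y⟫) (innerSL ℝ P) y := (innerSL ℝ P).hasFDerivAt
  have h3 := h2.mul h1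
  have h4 := (((hasFDerivAt_id y).const_add P).const_smul (1 / 2 : ℝ)).add (h3.smul_const P)
  refine h4.congr_fderiv ?_
  change _ = TD P y
  rw [TD]
  congr 2
  have hs : Real.sqrt (‖y‖ ^ 2 + ‖P‖ ^ 2) = enP P y := rfl
  rw [fD]
  ext v
  simp [hs]
  field_simp
  ring

lemma det_TD (P y : R3) (hy : y ≠ 0) :
    (TD P y).det = 1 / 2 * (‖TP P y‖ * ‖P - TP P y‖) / (‖y‖ * enP P y) := by
  have h0 : 0 < ‖y‖ := norm_pos_iff.2 hy
  have hE : 0 < enP P y := (norm_nonneg P).trans_lt (norm_lt_enP P y hy)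
  have hE2 := enP_sq P y
  have e : ((TD P y : R3 →L[ℝ] R3) : R3 →ₗ[ℝ] R3) = (1 / 2 : ℝ) • LinearMap.transvection
      ((2 : ℝ) • ((fD P y : R3 →L[ℝ] ℝ) : R3 →ₗ[ℝ] ℝ)) P := by
    ext1 v
    simp [TD, LinearMap.transvection.apply, smul_smul]
  rw [ContinuousLinearMap.det, e, LinearMap.det_smul, LinearMap.transvection.det,
    finrank_euclideanSpace_fin, norm_TP P y hy, norm_sub_TP P y hy]
  simp only [fD, LinearMap.smul_apply, ContinuousLinearMap.coe_coe, add_apply,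
    smul_apply, innerSL_apply_apply, real_inner_self_eq_norm_sq, smul_eq_mul,
    real_inner_comm P y]
  rw [show ‖P‖ ^ 2 = enP P y ^ 2 - ‖y‖ ^ 2 by linarith]
  generalize enP P y = E at *
  generalize ‖y‖ = r at *
  have : E + r ≠ 0 := by positivity
  field_simp
  ring

lemma image_TP (P : R3) : TP P '' {0}ᶜ = {p : R3 | relMom p (P - p) = 0}ᶜ := by
  ext p
  constructor
  · rintro ⟨y, hy, rfl⟩
    have hy : y ≠ 0 := hy
    change ¬ (relMom _ _ = 0)
    rw [relMom_TP P y hy]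
    simpa using hy
  · intro hp
    have hp : relMom p (P - p) ≠ 0 := hp
    refine ⟨SP P p, ?_, TP_SP P p hp⟩
    change SP P p ≠ 0
    rw [← norm_ne_zero_iff, norm_SP P p hp]
    exact hp

lemma fixedP (P : R3) (G : R3 → ENNReal) :
    ∫⁻ p : R3, G p / ENNReal.ofReal (‖p‖ * ‖P - p‖)
      = ∫⁻ y : R3, ENNReal.ofReal (1 / 2 / (‖y‖ * enP P y)) * G (TP P y) := by
  have hinj : Set.InjOn (TP P) {0}ᶜ := fun y hy z hz h => by
    rw [← SP_TP P y hy, ← SP_TP P z hz, h]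
  have h := lintegral_image_eq_lintegral_abs_det_fderiv_mul (volume : Measure R3)
    (measurableSet_singleton (0 : R3)).compl
    (fun y hy => (hasFDerivAt_TP P y hy).hasFDerivWithinAt) hinj
    (fun p => G p / ENNReal.ofReal (‖p‖ * ‖P - p‖))
  have h1 : (volume : Measure R3).restrict (TP P '' {0}ᶜ) = volume := by
    rw [image_TP]
    exact Measure.restrict_eq_self_of_ae_mem (measure_eq_zero_iff_ae_notMem.1 (relMom_zero_null P))
  rw [h1] at h
  rw [h, ← lintegral_indicator (measurableSet_singleton (0 : R3)).compl]
  apply lintegral_congr_ae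
  have h0 : ∀ᵐ y : R3, y ≠ 0 := by
    simp [ae_iff]
  filter_upwards [h0] with y hy
  rw [Set.indicator_of_mem (by exact hy)]
  have hr : 0 < ‖y‖ := norm_pos_iff.2 hy
  have hE : 0 < enP P y := (norm_nonneg P).trans_lt (norm_lt_enP P y hy)
  have hb := abs_lt.1 (abs_inner_div_lt P y hy)
  have hpos : 0 < ‖TP P y‖ * ‖P - TP P y‖ := by
    rw [norm_TP P y hy, norm_sub_TP P y hy]
    apply mul_pos <;> linarith
  rw [det_TD P y hy, abs_of_pos (by positivity), ENNReal.div_eq_inv_mul, ← mul_assoc,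
    ← ENNReal.ofReal_inv_of_pos hpos, ← ENNReal.ofReal_mul (by positivity)]
  congr 2
  field_simp
  exact div_self hpos.ne'

lemma polar (k : R3 → ENNReal) (hk : Measurable k) :
    ∫⁻ y : R3, k y = ∫⁻ ω : sphere (0 : R3) 1, ∫⁻ r : Set.Ioi (0 : ℝ),
      k ((r : ℝ) • (ω : R3)) ∂(Measure.volumeIoiPow 2) ∂sphMeasure := by
  have hmp := (volume : Measure R3).measurePreserving_homeomorphUnitSphereProd
  rw [finrank_euclideanSpace_fin] at hmp
  have hm : Measurable fun z : sphere (0 : R3) 1 × Set.Ioi (0 : ℝ) => k ((z.2 : ℝ) • (z.1 : R3)) :=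
    hk.comp (by fun_prop)
  have h := hmp.lintegral_comp hm
  rw [lintegral_prod _ hm.aemeasurable] at h
  change _ = ∫⁻ ω, ∫⁻ r, _ ∂(Measure.volumeIoiPow 2) ∂sphMeasure at h
  rw [← h]
  have e : ∀ a : ({0}ᶜ : Set R3), k (((homeomorphUnitSphereProd R3 a).2 : ℝ) •
      ((homeomorphUnitSphereProd R3 a).1 : R3)) = k a := by
    intro a
    rw [← homeomorphUnitSphereProd_symm_apply_coe, Homeomorph.symm_apply_apply]
  simp only [e]
  rw [lintegral_subtype_comap (measurableSet_singleton (0 : R3)).compl k]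
  rw [restrict_compl_singleton]

lemma sph_univ : sphMeasure Set.univ = ENNReal.ofReal (4 * π) := by
  rw [sphMeasure, Measure.toSphere_apply_univ, EuclideanSpace.volume_ball_fin_three,
    finrank_euclideanSpace_fin]
  rw [show ((3 : ℕ) : ENNReal) = ENNReal.ofReal 3 by simp, ENNReal.ofReal_one, one_pow, one_mul,
    ← ENNReal.ofReal_mul (by norm_num)]
  congr 1
  ring

instance : IsFiniteMeasure sphMeasure := by
  unfold sphMeasure; infer_instance

lemma spherical_average (k : R3 → ENNReal) (hk : Measurable k) :
    ∫⁻ y : R3, ∫⁻ ω : sphere (0 : R3) 1, k (‖y‖ • (ω : R3)) ∂sphMeasure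
      = ENNReal.ofReal (4 * π) * ∫⁻ y : R3, k y := by
  have hm : Measurable fun z : R3 × sphere (0 : R3) 1 => k (‖z.1‖ • (z.2 : R3)) :=
    hk.comp (by fun_prop)
  rw [polar _ hm.lintegral_prod_right']
  have e : ∀ (ω' : sphere (0 : R3) 1) (r : Set.Ioi (0 : ℝ)), ‖(r : ℝ) • (ω' : R3)‖ = r := by
    intro ω' r
    have h1 : ‖(ω' : R3)‖ = 1 := by simp
    rw [norm_smul, h1, mul_one, Real.norm_of_nonneg r.2.le]
  simp only [e]
  rw [lintegral_const, sph_univ, mul_comm, polar k hk, lintegral_lintegral_swap]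
  have hm : Measurable fun z : sphere (0 : R3) 1 × Set.Ioi (0 : ℝ) => k ((z.2 : ℝ) • (z.1 : R3)) :=
    hk.comp (by fun_prop)
  exact (hm.comp measurable_swap).aemeasurable

lemma to_total (G : R3 → R3 → ENNReal) (hG : Measurable (Function.uncurry G)) :
    ∫⁻ p : R3, ∫⁻ q : R3, G p q / ENNReal.ofReal (‖p‖ * ‖q‖)
      = ∫⁻ P : R3, ∫⁻ y : R3, ENNReal.ofReal (1 / 2 / (‖y‖ * enP P y)) *
          G (TP P y) (P - TP P y) := by
  have h1 : ∀ p : R3, ∫⁻ q : R3, G p q / ENNReal.ofReal (‖p‖ * ‖q‖)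
      = ∫⁻ P : R3, G p (P - p) / ENNReal.ofReal (‖p‖ * ‖P - p‖) := fun p =>
    (lintegral_sub_right_eq_self (fun q => G p q / ENNReal.ofReal (‖p‖ * ‖q‖)) p).symm
  simp only [h1]
  rw [lintegral_lintegral_swap]
  · exact lintegral_congr fun P => fixedP P (fun p => G p (P - p))
  · apply Measurable.aemeasurable
    have : Measurable fun z : R3 × R3 => G z.1 (z.2 - z.1) :=
      hG.comp (by fun_prop : Measurable fun z : R3 × R3 => (z.1, z.2 - z.1))
    exact this.div (by fun_prop)

lemma measurable_TP (P : R3) : Measurable (TP P) := by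
  unfold TP enP
  fun_prop

lemma measurable_post : Measurable fun z : (R3 × R3) × sphere (0 : R3) 1 =>
    (pPost z.1.1 z.1.2 z.2, qPost z.1.1 z.1.2 z.2) := by
  unfold pPost qPost relMom
  fun_prop

/-- The pre-post collisional change of variables:
`∭ F(p',q')/(|p||q|) dω d³q d³p = 4π ∬ F(p,q)/(|p||q|) d³q d³p`. -/
theorem collision_change_of_variables (F : R3 × R3 → ENNReal) (hF : Measurable F) :
    (∫⁻ p : R3, ∫⁻ q : R3, ∫⁻ ω : sphere (0 : R3) 1,
        F (pPost p q (ω : R3), qPost p q (ω : R3)) / ENNReal.ofReal (‖p‖ * ‖q‖)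
          ∂sphMeasure)
      = ENNReal.ofReal (4 * π)
          * ∫⁻ p : R3, ∫⁻ q : R3, F (p, q) / ENNReal.ofReal (‖p‖ * ‖q‖) := by
  have hF' : Measurable (Function.uncurry fun p q : R3 => F (p, q)) := by
    have : (Function.uncurry fun p q : R3 => F (p, q)) = F := by
      funext x; rfl
    rw [this]; exact hF
  have hm := hF.comp measurable_post
  have hH : Measurable (Function.uncurry fun p q : R3 => ∫⁻ ω : sphere (0 : R3) 1,
      F (pPost p q (ω : R3), qPost p q (ω : R3)) ∂sphMeasure) :=
    Measurable.lintegral_prod_right' hm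
  have e1 : ∀ p q : R3, ∫⁻ ω : sphere (0 : R3) 1,
        F (pPost p q (ω : R3), qPost p q (ω : R3)) / ENNReal.ofReal (‖p‖ * ‖q‖) ∂sphMeasure
      = (∫⁻ ω : sphere (0 : R3) 1,
        F (pPost p q (ω : R3), qPost p q (ω : R3)) ∂sphMeasure) / ENNReal.ofReal (‖p‖ * ‖q‖) := by
    intro p q
    simp only [div_eq_mul_inv]
    have hpq : Measurable fun ω : sphere (0 : R3) 1 =>
        F (pPost p q (ω : R3), qPost p q (ω : R3)) := by
      refine hF.comp ?_
      unfold pPost qPost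
      fun_prop
    exact lintegral_mul_const _ hpq
  simp only [e1]
  rw [to_total _ hH, to_total (fun p q => F (p, q)) hF',
    ← lintegral_const_mul' _ _ ENNReal.ofReal_ne_top]
  refine lintegral_congr fun P => ?_
  have hk : Measurable fun y : R3 => ENNReal.ofReal (1 / 2 / (‖y‖ * enP P y)) *
      F (TP P y, P - TP P y) := by
    have hT := measurable_TP P
    have : Measurable fun y : R3 => F (TP P y, P - TP P y) :=
      hF.comp (hT.prodMk (measurable_const.sub hT))
    refine Measurable.mul ?_ this
    unfold enP
    fun_prop
  rw [← spherical_average _ hk]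
  apply lintegral_congr_ae
  have h0 : ∀ᵐ y : R3, y ≠ 0 := by
    simp [ae_iff]
  filter_upwards [h0] with y hy
  rw [← lintegral_const_mul' _ _ ENNReal.ofReal_ne_top]
  refine lintegral_congr fun ω => ?_
  have hω : ‖(ω : R3)‖ = 1 := by simp
  have hr := relMom_TP P y hy
  have hr0 : relMom (TP P y) (P - TP P y) ≠ 0 := by rw [hr]; simpa using hy
  have hn : ‖‖y‖ • (ω : R3)‖ = ‖y‖ := by rw [norm_smul, hω, mul_one, norm_norm]
  rw [qPost_eq, pPost_eq P _ _ hω hr0, hr, hn]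
  simp only [enP, hn]
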